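/- Under the Hypothesis, the action of the twisted wreath product G = N ⋊ P by left multiplication on the coset space G/P is faithful and quasiprimitive (every nontrivial normal subgroup of G acts transitively on G/P); moreover the normal subgroup N acts regularly on G/P, i.e. transitively with trivial point stabilisers. -/

import Mathlib

/-!  The base group `N` of the twisted wreath product `T twr_φ P`, and the action of
`P` on it.  (The paper lets automorphisms and groups act on the right; in Lean,
automorphisms are applied on the left, so the construction is mirrored left-to-right:
`N` consists of the functions `f : P → T` with `f (q * h) = φ q (f h)`, and `g ∈ P`
acts on `N` by `(g • f) (h) = f (h * g)`.) -/

/-- The base group `N = { f : P → T | f(qh) = φ(q)(f(h)) for all h ∈ P, q ∈ Q }` of a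
twisted wreath product, a subgroup of the direct product `∏_P T` with pointwise
multiplication. -/
def twN {P T : Type*} [Group P] [Group T] (Q : Subgroup P) (φ : Q →* MulAut T) :
    Subgroup (P → T) where
  carrier := {f | ∀ (h : P) (q : Q), f (↑q * h) = φ q (f h)}
  one_mem' := by intro h q; simp
  mul_mem' := by
    intro f g hf hg h q
    simp only [Pi.mul_apply, hf h q, hg h q, map_mul]
  inv_mem' := by
    intro f hf h q
    simp only [Pi.inv_apply, hf h q, map_inv]

theorem mem_twN_iff {P T : Type*} [Group P] [Group T] (Q : Subgroup P)
    (φ : Q →* MulAut T) (f : P → T) :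
    f ∈ twN Q φ ↔ ∀ (h : P) (q : Q), f (↑q * h) = φ q (f h) := Iff.rfl

/-- The (translation) action of `P` on the base group `N` of the twisted wreath
product, `(g • f) (h) = f (h * g)`. -/
def twAct {P T : Type*} [Group P] [Group T] (Q : Subgroup P) (φ : Q →* MulAut T) :
    P →* MulAut (twN Q φ) where
  toFun g :=
    { toFun := fun f => ⟨fun h => (f : P → T) (h * g), by
        intro h q
        simpa [mul_assoc] using f.2 (h * g) q⟩
      invFun := fun f => ⟨fun h => (f : P → T) (h * g⁻¹), by
        intro h q
        simpa [mul_assoc] using f.2 (h * g⁻¹) q⟩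
      left_inv := fun f => Subtype.ext (funext fun h => by simp)
      right_inv := fun f => Subtype.ext (funext fun h => by simp)
      map_mul' := fun f₁ f₂ => rfl }
  map_one' := by
    ext f
    exact congrFun (congrArg Subtype.val (Subtype.ext (funext fun h => by simp))) _
  map_mul' := fun g₁ g₂ => by
    ext f
    exact congrFun (congrArg Subtype.val (Subtype.ext (funext fun h => by
      simp [mul_assoc]))) _

open scoped Classical in
/-- The element of `N` supported on the coset `Q h`, with value `t` at `h`. -/
noncomputable def twE {P T : Type*} [Group P] [Group T] (Q : Subgroup P) (φ : Q →* MulAut T)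
    (h : P) : T →* twN Q φ where
  toFun t := ⟨fun x => if hx : x * h⁻¹ ∈ Q then φ ⟨_, hx⟩ t else 1, by
    intro x q
    by_cases hx : x * h⁻¹ ∈ Q
    · have hx' : (q : P) * x * h⁻¹ ∈ Q := by
        rw [mul_assoc]; exact Q.mul_mem q.2 hx
      have : (⟨(q : P) * x * h⁻¹, hx'⟩ : Q) = q * ⟨x * h⁻¹, hx⟩ :=
        Subtype.ext (by simp [mul_assoc])
      simp only [hx, hx', dif_pos, this, map_mul, MulAut.mul_apply]
    · have hx' : (q : P) * x * h⁻¹ ∉ Q := by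
        rw [mul_assoc, Subgroup.mul_mem_cancel_left _ q.2]; exact hx
      simp only [hx, hx', dif_neg, not_false_eq_true, map_one]⟩
  map_one' := by
    ext x
    by_cases hx : x * h⁻¹ ∈ Q <;> simp [hx]
  map_mul' s t := by
    ext x
    by_cases hx : x * h⁻¹ ∈ Q <;> simp [hx]

section
variable {P T : Type*} [Group P] [Group T] (Q : Subgroup P) (φ : Q →* MulAut T)

theorem twE_mem (h : P) (t : T) (q : Q) : (twE Q φ h t : P → T) (q * h) = φ q t := by
  have : (q : P) * h * h⁻¹ ∈ Q := by simp
  simp [twE]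

theorem twE_self (h : P) (t : T) : (twE Q φ h t : P → T) h = t := by
  have := twE_mem Q φ h t 1
  simpa using this

theorem twE_not (h x : P) (t : T) (hx : x * h⁻¹ ∉ Q) : (twE Q φ h t : P → T) x = 1 := by
  simp [twE, hx]

theorem twN_apply (f : twN Q φ) (h : P) (q : Q) : (f : P → T) (q * h) = φ q ((f : P → T) h) :=
  f.2 h q

theorem twAct_apply (f : twN Q φ) (g h : P) :
    (twAct Q φ g f : P → T) h = (f : P → T) (h * g) := rfl

theorem twE_conj (f : twN Q φ) (h : P) (t : T) :
    f * twE Q φ h t * f⁻¹ = twE Q φ h ((f : P → T) h * t * ((f : P → T) h)⁻¹) := by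
  ext x
  by_cases hx : x * h⁻¹ ∈ Q
  · obtain ⟨q, rfl⟩ : ∃ q : Q, x = q * h := ⟨⟨_, hx⟩, by simp⟩
    simp only [Subgroup.coe_mul, Subgroup.coe_inv, Pi.mul_apply, Pi.inv_apply, twN_apply,
      twE_self, map_mul, map_inv]
  · simp [twE_not Q φ h x _ hx]

theorem twAct_twE (g h : P) (t : T) : twAct Q φ g (twE Q φ h t) = twE Q φ (h * g⁻¹) t := by
  ext x
  rw [twAct_apply]
  by_cases hx : x * g * h⁻¹ ∈ Q
  · obtain ⟨q, rfl⟩ : ∃ q : Q, x = q * (h * g⁻¹) := ⟨⟨_, hx⟩, by simp [mul_assoc]⟩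
    rw [twE_mem]
    have : (q : P) * (h * g⁻¹) * g = q * h := by simp [mul_assoc]
    rw [this, twE_mem]
  · rw [twE_not Q φ h _ _ hx, twE_not]
    simpa [mul_assoc] using hx

theorem tw_center [IsSimpleGroup T] (hTna : ∃ a b : T, a * b ≠ b * a) (t : T)
    (ht : ∀ s, t * s = s * t) : t = 1 := by
  rcases (inferInstance : (Subgroup.center T).Normal).eq_bot_or_eq_top with h | h
  · have : t ∈ Subgroup.center T := Subgroup.mem_center_iff.2 fun s => (ht s).symm
    rwa [h, Subgroup.mem_bot] at this
  · obtain ⟨a, b, hab⟩ := hTna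
    have : b ∈ Subgroup.center T := h ▸ Subgroup.mem_top b
    exact absurd (Subgroup.mem_center_iff.1 this a) hab

theorem tw_minimal [Finite P] [IsSimpleGroup T] (hTna : ∃ a b : T, a * b ≠ b * a)
    (L : Subgroup (twN Q φ)) (hL : L.Normal) (hP : ∀ g, ∀ f ∈ L, twAct Q φ g f ∈ L)
    (hne : L ≠ ⊥) : L = ⊤ := by
  classical
  obtain ⟨⟨f, hfL⟩, hf0⟩ := L.ne_bot_iff_exists_ne_one.1 hne
  have hf1 : f ≠ 1 := fun h => hf0 (Subtype.ext h)
  obtain ⟨h, hh⟩ : ∃ h, (f : P → T) h ≠ 1 := by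
    by_contra! hc
    exact hf1 (Subtype.ext (funext hc))
  obtain ⟨t, ht⟩ : ∃ t, (f : P → T) h * t ≠ t * (f : P → T) h := by
    by_contra! hc
    exact hh (tw_center hTna _ hc)
  have hS : (L.comap (twE Q φ h)).Normal := inferInstance
  have htop : L.comap (twE Q φ h) = ⊤ := by
    rcases hS.eq_bot_or_eq_top with hb | hb
    · exfalso
      have hm : (f : P → T) h * t * ((f : P → T) h)⁻¹ * t⁻¹ ∈ L.comap (twE Q φ h) := by
        rw [Subgroup.mem_comap, map_mul, ← twE_conj, map_inv]
        have : f * twE Q φ h t * f⁻¹ * (twE Q φ h t)⁻¹ =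
          f * (twE Q φ h t * f⁻¹ * (twE Q φ h t)⁻¹) := by group
        rw [this]
        exact L.mul_mem hfL (hL.conj_mem _ (L.inv_mem hfL) _)
      rw [hb, Subgroup.mem_bot, mul_inv_eq_one, mul_inv_eq_iff_eq_mul] at hm
      exact ht hm
    · exact hb
  have hall : ∀ x s, twE Q φ x s ∈ L := by
    intro x s
    have h1 : twE Q φ h s ∈ L := by
      have : s ∈ L.comap (twE Q φ h) := htop ▸ Subgroup.mem_top s
      exact this
    have h2 := hP (x⁻¹ * h) _ h1
    rw [twAct_twE] at h2
    simpa using h2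
  rw [eq_top_iff]
  intro k _
  have key : ∀ n : ℕ, ∀ k : twN Q φ, {x | (k : P → T) x ≠ 1}.ncard = n → k ∈ L := by
    intro n
    induction n using Nat.strong_induction_on with
    | _ n ih =>
      intro k hk
      by_cases hk1 : k = 1
      · rw [hk1]; exact L.one_mem
      obtain ⟨y, hy⟩ : ∃ h, (k : P → T) h ≠ 1 := by
        by_contra! hc
        exact hk1 (Subtype.ext (funext hc))
      set e := twE Q φ y ((k : P → T) y) with he
      have hval : ∀ q : Q, ((k * e⁻¹ : twN Q φ) : P → T) (q * y) = 1 := by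
        intro q
        simp [he, twE_self, twN_apply]
      have hlt : {x | ((k * e⁻¹ : twN Q φ) : P → T) x ≠ 1}.ncard < n := by
        rw [← hk]
        apply Set.ncard_lt_ncard _ (Set.toFinite _)
        refine (Set.ssubset_iff_of_subset ?_).2 ⟨y, hy, ?_⟩
        · intro x hx
          by_cases hq : x * y⁻¹ ∈ Q
          · exfalso
            apply hx
            have := hval ⟨_, hq⟩
            simpa using this
          · simpa [he, twE_not Q φ y x _ hq] using hx
        · have := hval 1
          simp only [Subgroup.coe_one, one_mul] at this
          simp only [Set.mem_setOf_eq, not_not]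
          exact this
      have := L.mul_mem (ih _ hlt _ rfl) (hall y ((k : P → T) y))
      simpa [← he] using this
  exact key _ k rfl

theorem tw_core (V : Subgroup P) (hVnorm : V.Normal) (hcompl : Subgroup.IsComplement' V Q)
    (hfaith : ∀ q ∈ Q, (∀ v ∈ V, q * v * q⁻¹ = v) → q = 1)
    (g : P) (hg : ∀ h, h * g * h⁻¹ ∈ Q) : g = 1 := by
  have hgQ : g ∈ Q := by simpa using hg 1
  refine hfaith g hgQ fun v hv => ?_
  have h1 : v * (g * v⁻¹ * g⁻¹) ∈ V := V.mul_mem hv (hVnorm.conj_mem _ (V.inv_mem hv) _)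
  have h2 : v * (g * v⁻¹ * g⁻¹) ∈ Q := by
    have := Q.mul_mem (hg v) (Q.inv_mem hgQ)
    simpa [mul_assoc] using this
  have h3 := Subgroup.disjoint_def.1 hcompl.disjoint h1 h2
  have := eq_inv_of_mul_eq_one_left h3
  rw [eq_comm]
  calc v = (g * v⁻¹ * g⁻¹)⁻¹ := this
    _ = g * v * g⁻¹ := by group

theorem tw_centralizer [IsSimpleGroup T] (hTna : ∃ a b : T, a * b ≠ b * a)
    (hcore : ∀ g : P, (∀ h, h * g * h⁻¹ ∈ Q) → g = 1)
    (n : twN Q φ) (g : P) (hc : ∀ f, n * twAct Q φ g f * n⁻¹ = f) : n = 1 ∧ g = 1 := by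
  have hv : ∀ (f : twN Q φ) h, (n : P → T) h * (f : P → T) (h * g) * ((n : P → T) h)⁻¹
      = (f : P → T) h := by
    intro f h
    exact congrFun (congrArg Subtype.val (hc f)) h
  obtain ⟨t, ht⟩ := exists_ne (1 : T)
  have hg : g = 1 := by
    refine hcore g fun h => ?_
    by_contra hq
    have := hv (twE Q φ h t) h
    rw [twE_self, twE_not Q φ h _ _ hq] at this
    apply ht
    simpa using this.symm
  refine ⟨Subtype.ext (funext fun h => tw_center hTna _ fun s => ?_), hg⟩
  have := hv (twE Q φ h s) h
  rw [hg, mul_one, twE_self, mul_inv_eq_iff_eq_mul] at this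
  exact this

theorem tw_normal [Finite P] [IsSimpleGroup T] (hTna : ∃ a b : T, a * b ≠ b * a)
    (hcore : ∀ g : P, (∀ h, h * g * h⁻¹ ∈ Q) → g = 1)
    (M : Subgroup (twN Q φ ⋊[twAct Q φ] P)) (hM : M.Normal) (hne : M ≠ ⊥) (f : twN Q φ) :
    (SemidirectProduct.inl f : twN Q φ ⋊[twAct Q φ] P) ∈ M := by
  have htop : M.comap SemidirectProduct.inl = ⊤ := by
    refine tw_minimal Q φ hTna _ inferInstance ?_ ?_
    · intro g f hf
      rw [Subgroup.mem_comap] at hf ⊢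
      rw [SemidirectProduct.inl_aut]
      have := hM.conj_mem _ hf (SemidirectProduct.inr g)
      rwa [← map_inv] at this
    · intro hb
      apply hne
      rw [eq_bot_iff]
      intro m hm
      have hcomm : ∀ f : twN Q φ, m.left * twAct Q φ m.right f * m.left⁻¹ = f := by
        intro f
        have h1 : m * SemidirectProduct.inl f * m⁻¹ * (SemidirectProduct.inl f)⁻¹ ∈ M := by
          have := M.mul_mem hm (hM.conj_mem _ (M.inv_mem hm) (SemidirectProduct.inl f))
          simpa [mul_assoc] using this
        have h2 : m * SemidirectProduct.inl f * m⁻¹ * (SemidirectProduct.inl f)⁻¹ =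
            SemidirectProduct.inl (m.left * twAct Q φ m.right f * m.left⁻¹ * f⁻¹) := by
          ext1 <;> simp [mul_assoc]
        rw [h2] at h1
        have h3 : m.left * twAct Q φ m.right f * m.left⁻¹ * f⁻¹ ∈
          M.comap (SemidirectProduct.inl : twN Q φ →* twN Q φ ⋊[twAct Q φ] P) := h1
        rw [hb, Subgroup.mem_bot, mul_inv_eq_one] at h3
        exact h3
      obtain ⟨h1, h2⟩ := tw_centralizer Q φ hTna hcore _ _ hcomm
      exact SemidirectProduct.ext h1 h2
  have : f ∈ M.comap (SemidirectProduct.inl : twN Q φ →* twN Q φ ⋊[twAct Q φ] P) :=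
    htop ▸ Subgroup.mem_top f
  exact this

end

/-- Under the Hypothesis, the action of the twisted wreath product `G = N ⋊ P` by
translation on the coset space `G/P` is faithful and quasiprimitive (every
nontrivial normal subgroup of `G` acts transitively); moreover the normal subgroup
`N` acts regularly on `G/P`, i.e. transitively with trivial point stabilisers. -/
theorem stmt_11
    -- The Hypothesis --
    (p : ℕ) (hp : p.Prime)
    {P : Type*} [Group P] [Fintype P]
    -- `V` and `Q` are identified with subgroups of `P = V ⋊ Q`:
    (V Q : Subgroup P) (hVnorm : V.Normal)
    -- every element of `P` is uniquely a product `v * q` with `v ∈ V`, `q ∈ Q`: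
    (hcompl : Subgroup.IsComplement' V Q)
    -- `V` is a (finite) vector space over `𝔽_p`, i.e. elementary abelian of exponent `p`:
    (hVab : ∀ a ∈ V, ∀ b ∈ V, a * b = b * a) (hVp : ∀ a ∈ V, a ^ p = 1)
    -- of order `k = |V| ≥ 2`:
    (hVcard : 2 ≤ Nat.card V)
    -- the (conjugation) action of `Q` on `V` is faithful:
    (hfaith : ∀ q ∈ Q, (∀ v ∈ V, q * v * q⁻¹ = v) → q = 1)
    -- and transitive on the nonzero vectors of `V`:
    (htrans : ∀ v ∈ V, ∀ w ∈ V, v ≠ 1 → w ≠ 1 → ∃ q ∈ Q, q * v * q⁻¹ = w)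
    -- `T` is a finite nonabelian simple group:
    {T : Type*} [Group T] [Finite T] [IsSimpleGroup T]
    (hTna : ∃ a b : T, a * b ≠ b * a)
    -- and `φ : Q → Aut T` is a homomorphism whose image contains `Inn T`:
    (φ : Q →* MulAut T) (hφ : ∀ t : T, MulAut.conj t ∈ φ.range)
    :
    ∀ Pr : Subgroup (twN Q φ ⋊[twAct Q φ] P),
      -- `Pr` is the subgroup `P` of `G`:
      Pr = SemidirectProduct.inr.range →
      -- the action of `G` on `G/P` is faithful,
      ((∀ g : twN Q φ ⋊[twAct Q φ] P,
          (∀ x : (twN Q φ ⋊[twAct Q φ] P) ⧸ Pr, g • x = x) → g = 1) ∧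
      -- quasiprimitive,
      (∀ M : Subgroup (twN Q φ ⋊[twAct Q φ] P), M.Normal → M ≠ ⊥ →
          ∀ x y : (twN Q φ ⋊[twAct Q φ] P) ⧸ Pr, ∃ m ∈ M, m • x = y) ∧
      -- and the normal subgroup `N` acts transitively
      (∀ x y : (twN Q φ ⋊[twAct Q φ] P) ⧸ Pr,
          ∃ n ∈ (SemidirectProduct.inl : twN Q φ →* twN Q φ ⋊[twAct Q φ] P).range, n • x = y) ∧
      -- with trivial point stabilisers (regularly).
      (∀ n ∈ (SemidirectProduct.inl : twN Q φ →* twN Q φ ⋊[twAct Q φ] P).range,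
          ∀ x : (twN Q φ ⋊[twAct Q φ] P) ⧸ Pr, n • x = x → n = 1)) := by
  intro Pr hPr
  have hcore := tw_core Q V hVnorm hcompl hfaith
  have hrep : ∀ x : (twN Q φ ⋊[twAct Q φ] P) ⧸ Pr, ∃ f : twN Q φ,
      x = QuotientGroup.mk (SemidirectProduct.inl f) := by
    intro x
    induction x using QuotientGroup.induction_on with
    | H z =>
      refine ⟨z.left, Eq.symm (QuotientGroup.eq.2 ?_)⟩
      rw [hPr]
      refine ⟨z.right, ?_⟩
      rw [eq_inv_mul_iff_mul_eq, SemidirectProduct.inl_left_mul_inr_right]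
  have htransN : ∀ x y : (twN Q φ ⋊[twAct Q φ] P) ⧸ Pr,
      ∃ n : twN Q φ, (SemidirectProduct.inl n : twN Q φ ⋊[twAct Q φ] P) • x = y := by
    intro x y
    obtain ⟨a, rfl⟩ := hrep x
    obtain ⟨b, rfl⟩ := hrep y
    refine ⟨b * a⁻¹, ?_⟩
    rw [MulAction.Quotient.smul_mk, smul_eq_mul, ← map_mul, inv_mul_cancel_right]
  have hreg : ∀ (n : twN Q φ) (x : (twN Q φ ⋊[twAct Q φ] P) ⧸ Pr),
      (SemidirectProduct.inl n : twN Q φ ⋊[twAct Q φ] P) • x = x → n = 1 := by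
    intro n x hx
    obtain ⟨a, rfl⟩ := hrep x
    rw [MulAction.Quotient.smul_mk, smul_eq_mul, ← map_mul, QuotientGroup.eq, hPr] at hx
    obtain ⟨g, hg⟩ := hx
    rw [← map_inv, ← map_mul] at hg
    have := congrArg SemidirectProduct.left hg
    simp only [SemidirectProduct.left_inr, SemidirectProduct.left_inl] at this
    have h2 : n * a = a := (inv_mul_eq_one.1 this.symm)
    simpa using h2
  refine ⟨?_, ?_, ?_, ?_⟩
  · intro g hg
    by_contra hg1
    let K := (MulAction.toPermHom (twN Q φ ⋊[twAct Q φ] P)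
      ((twN Q φ ⋊[twAct Q φ] P) ⧸ Pr)).ker
    have hgK : g ∈ K := MonoidHom.mem_ker.2 (Equiv.ext hg)
    have hK : K ≠ ⊥ := by
      intro hb
      rw [hb, Subgroup.mem_bot] at hgK
      exact hg1 hgK
    obtain ⟨t, ht⟩ := exists_ne (1 : T)
    have h1 := tw_normal Q φ hTna hcore K inferInstance hK (twE Q φ 1 t)
    have h2 := hreg (twE Q φ 1 t) (QuotientGroup.mk 1)
      (Equiv.congr_fun (MonoidHom.mem_ker.1 h1) (QuotientGroup.mk 1))
    apply ht
    have h3 := twE_self Q φ 1 t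
    rw [h2] at h3
    exact h3.symm
  · intro M hM hne x y
    obtain ⟨n, hn⟩ := htransN x y
    exact ⟨_, tw_normal Q φ hTna hcore M hM hne n, hn⟩
  · intro x y
    obtain ⟨n, hn⟩ := htransN x y
    exact ⟨_, ⟨n, rfl⟩, hn⟩
  · rintro _ ⟨n, rfl⟩ x hx
    rw [hreg n x hx, map_one]
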